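/- With M, X, e, f, C, A, M', C', A' and ω as in the setup: for any row i ∈ X−e and columns j, k ∈ (E−X)−f, A_{ij} = A_{ik} if and only if A'_{ij} = A'_{ik}; and for any rows i, k ∈ X−e and column j ∈ (E−X)−f, A_{ij} = A_{kj} if and only if A'_{ij} = A'_{kj}. -/

import Mathlib

open Matroid Set
open scoped Classical

namespace Relax

variable {α β : Type*}

/-- A circuit of a matroid: a minimal dependent set. -/
def Circuit (M : Matroid α) (C : Set α) : Prop :=
  M.Dep C ∧ ∀ D ⊂ C, M.Indep D

/-- A hyperplane of a matroid: a maximal proper flat. -/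
def Hyperplane (M : Matroid α) (H : Set α) : Prop :=
  M.IsFlat H ∧ H ≠ M.E ∧ ∀ F, M.IsFlat F → H ⊂ F → F = M.E

/-- `X` is a circuit-hyperplane of `M`. -/
def CircuitHyperplane (M : Matroid α) (X : Set α) : Prop :=
  Circuit M X ∧ Hyperplane M X

/-- `M'` is obtained from `M` by relaxing the circuit-hyperplane `X` : the ground set is
unchanged and the bases of `M'` are exactly the bases of `M` together with `X`. -/
def IsRelaxation (M M' : Matroid α) (X : Set α) : Prop :=
  CircuitHyperplane M X ∧ M'.E = M.E ∧ ∀ B, (M'.IsBase B ↔ M.IsBase B ∨ B = X)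

/-- A matroid is representable over a field `F` if there is an assignment of vectors to its
elements under which independence coincides with linear independence. -/
def Representable (M : Matroid α) (F : Type*) [Field F] : Prop :=
  ∃ (n : ℕ) (φ : α → (Fin n → F)), ∀ I ⊆ M.E,
    (M.Indep I ↔ LinearIndependent F (fun x : I => φ (x : α)))

/-- The field GF(4). -/
abbrev GF4 := GaloisField 2 2

/-- The rank of a set in a matroid: the maximum size of an independent subset. -/
noncomputable def rk (M : Matroid α) (X : Set α) : ℕ :=
  sSup {n | ∃ I, M.Indep I ∧ I ⊆ X ∧ I.ncard = n}

/-- Deletion of a set of elements. -/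
def delete (M : Matroid α) (D : Set α) : Matroid α := M ↾ (M.E \ D)

/-- Contraction of a set of elements. -/
def contract (M : Matroid α) (C : Set α) : Matroid α := (delete M✶ C)✶

/-- `N` is a minor of `M`. -/
def MinorOf (N M : Matroid α) : Prop :=
  ∃ C D, C ⊆ M.E ∧ D ⊆ M.E ∧ Disjoint C D ∧ N = delete (contract M C) D

/-- Isomorphism of matroids. -/
def Iso (M : Matroid α) (N : Matroid β) : Prop :=
  ∃ e : M.E ≃ N.E, ∀ I : Set M.E,
    M.Indep ((↑) '' I) ↔ N.Indep ((↑) '' (e '' I))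

/-- `M` has a minor isomorphic to `N`. -/
def HasMinorIso (M : Matroid α) (N : Matroid β) : Prop :=
  ∃ M₀ : Matroid α, MinorOf M₀ M ∧ Iso M₀ N

/-- `M` has a minor isomorphic to a member of the set `𝒩` of matroids. -/
def HasMinorIn (M : Matroid α) (𝒩 : Set (Matroid β)) : Prop :=
  ∃ N ∈ 𝒩, HasMinorIso M N

/-- `M` is `𝒩`-fragile. -/
def Fragile (M : Matroid α) (𝒩 : Set (Matroid β)) : Prop :=
  HasMinorIn M 𝒩 ∧
    ∀ a ∈ M.E, ¬ (HasMinorIn (delete M {a}) 𝒩 ∧ HasMinorIn (contract M {a}) 𝒩)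

/-- `M` is (isomorphic to) the uniform matroid `U_{r,n}`. -/
def IsUniform (M : Matroid α) (r n : ℕ) : Prop :=
  M.E.Finite ∧ M.E.ncard = n ∧ ∀ I ⊆ M.E, (M.Indep I ↔ I.ncard ≤ r)

/-- `M` has a minor isomorphic to `U_{r,n}`. -/
def HasUnifMinor (M : Matroid α) (r n : ℕ) : Prop :=
  ∃ M₀, MinorOf M₀ M ∧ IsUniform M₀ r n

/-- `M` has a `{U_{2,5}, U_{3,5}}`-minor. -/
def HasU25U35Minor (M : Matroid α) : Prop :=
  HasUnifMinor M 2 5 ∨ HasUnifMinor M 3 5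

/-- `M` is `U_{2,4}`-fragile. -/
def FragileU24 (M : Matroid α) : Prop :=
  HasUnifMinor M 2 4 ∧
    ∀ a ∈ M.E, ¬ (HasUnifMinor (delete M {a}) 2 4 ∧ HasUnifMinor (contract M {a}) 2 4)

/-- `M` is `{U_{2,5}, U_{3,5}}`-fragile. -/
def FragileU25U35 (M : Matroid α) : Prop :=
  HasU25U35Minor M ∧
    ∀ a ∈ M.E, ¬ (HasU25U35Minor (delete M {a}) ∧ HasU25U35Minor (contract M {a}))

/-- A loop. -/
def Loop (M : Matroid α) (x : α) : Prop := x ∈ M.E ∧ ¬ M.Indep {x}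

/-- Two distinct non-loop elements are parallel if they form a two-element circuit. -/
def Parallel (M : Matroid α) (x y : α) : Prop := x ≠ y ∧ Circuit M {x, y}

/-- A parallel class: a maximal set of pairwise-parallel non-loop elements. -/
def ParallelClass (M : Matroid α) (A : Set α) : Prop :=
  A ⊆ M.E ∧ (∀ x ∈ A, ¬ Loop M x) ∧
    (∀ x ∈ A, ∀ y ∈ A, x ≠ y → Parallel M x y) ∧
    (∀ B, A ⊆ B → B ⊆ M.E → (∀ x ∈ B, ¬ Loop M x) →
      (∀ x ∈ B, ∀ y ∈ B, x ≠ y → Parallel M x y) → B = A)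

/-- A series class: a parallel class of the dual. -/
def SeriesClass (M : Matroid α) (A : Set α) : Prop := ParallelClass M✶ A

/-- A matroid is connected if every two distinct elements lie in a common circuit. -/
def Connected (M : Matroid α) : Prop :=
  ∀ x ∈ M.E, ∀ y ∈ M.E, x ≠ y → ∃ C, Circuit M C ∧ x ∈ C ∧ y ∈ C

/-- A `k`-separation of `M`. -/
def Separation (M : Matroid α) (k : ℕ) (A B : Set α) : Prop :=
  A ∪ B = M.E ∧ Disjoint A B ∧ k ≤ A.ncard ∧ k ≤ B.ncard ∧
    rk M A + rk M B ≤ rk M M.E + (k - 1)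

/-- A matroid is 3-connected if it is connected and has no 2-separation. -/
def ThreeConnected (M : Matroid α) : Prop :=
  Connected M ∧ ∀ A B, ¬ Separation M 2 A B

/-- `M` is 3-connected up to series and parallel classes. -/
def ThreeConnUpToSP (M : Matroid α) : Prop :=
  Connected M ∧ ∀ A B, Separation M 2 A B →
    (SeriesClass M A ∨ ParallelClass M A ∨ SeriesClass M B ∨ ParallelClass M B)

/-- A 3-separating set of `M`. -/
def ThreeSeparating (M : Matroid α) (Y : Set α) : Prop :=
  Y ⊆ M.E ∧ rk M Y + rk M (M.E \ Y) ≤ rk M M.E + 2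

/-- `M` has path width 3: there is an ordering of the ground set all of whose initial
segments are 3-separating. -/
def PathWidth3 (M : Matroid α) : Prop :=
  ∃ (n : ℕ) (e : Fin n → α), Function.Injective e ∧ Set.range e = M.E ∧
    ∀ t : Fin n, ThreeSeparating M (e '' {i | i ≤ t})

/-- A segment: every 3-element subset is a triangle. -/
def Segment (M : Matroid α) (S : Set α) : Prop :=
  S ⊆ M.E ∧ ∀ T ⊆ S, T.ncard = 3 → Circuit M T

/-- A triangle: a 3-element circuit. -/
def Triangle (M : Matroid α) (S : Set α) : Prop := Circuit M S ∧ S.ncard = 3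

/-! ### Reduced representations `[I | C]` with `C = [[A, 1], [1ᵀ, w]]` -/

/-- The column, indexed by `x`, of the matrix `[I | C]` whose rows are indexed by
`(X \ {e}) ∪ {f}`, where `C` is the block matrix `[[A, 1], [1ᵀ, w]]` with row block `X \ {e}`,
column block `(E \ X) \ {f}`, last column `e`, last row `f`, and corner entry `w`. -/
noncomputable def colVec (X : Set α) (e f : α) (A : α → α → GF4) (w : GF4) :
    α → ((X \ {e} ∪ {f} : Set α) → GF4) := fun x r =>
  if x ∈ X \ {e} ∪ ({f} : Set α) then (if (r : α) = x then 1 else 0)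
  else if (r : α) = f then (if x = e then w else 1)
  else if x = e then 1 else A (r : α) x

/-- `M = M[I | C]` where `C` is the block matrix `[[A, 1], [1ᵀ, w]]` relative to the
basis `(X \ {e}) ∪ {f}`. -/
def RepBy (M : Matroid α) (X : Set α) (e f : α) (A : α → α → GF4) (w : GF4) : Prop :=
  ∀ I ⊆ M.E, (M.Indep I ↔
    LinearIndependent GF4 (fun x : I => colVec X e f A w (x : α)))

/-- The matrix `B`, with rows restricted to `R` and columns restricted to `K`, has an
`m × n` submatrix (up to permuting rows and columns) equal to the pattern `P`. -/
def HasPattern {m n : ℕ} (B : α → α → GF4) (R K : Set α) (P : Fin m → Fin n → GF4) : Prop :=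
  ∃ (r : Fin m → α) (c : Fin n → α), Function.Injective r ∧ Function.Injective c ∧
    (∀ i, r i ∈ R) ∧ (∀ j, c j ∈ K) ∧ ∀ i j, B (r i) (c j) = P i j

/-- One non-zero element of GF(4). -/
def NZ1 (x : GF4) : Prop := x ≠ 0

/-- Two distinct non-zero elements of GF(4). -/
def NZ2 (x y : GF4) : Prop := x ≠ 0 ∧ y ≠ 0 ∧ x ≠ y

/-- Three distinct non-zero elements of GF(4). -/
def NZ3 (x y z : GF4) : Prop :=
  x ≠ 0 ∧ y ≠ 0 ∧ z ≠ 0 ∧ x ≠ y ∧ x ≠ z ∧ y ≠ z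

/-- `B` (with rows from `R` and columns from `K`) contains one of the fifteen forbidden
submatrices, up to permuting rows and columns, where `x, y, z` denote distinct non-zero
elements of GF(4). -/
def HasForbidden (B : α → α → GF4) (R K : Set α) : Prop :=
  (∃ x y z, NZ3 x y z ∧ HasPattern B R K ![![x, y, z]]) ∨
  (∃ x y, NZ2 x y ∧ HasPattern B R K ![![x, y], ![0, x]]) ∨
  (∃ x y, NZ2 x y ∧ HasPattern B R K ![![x, y], ![y, x]]) ∨
  (∃ x y z, NZ3 x y z ∧ HasPattern B R K ![![x, y], ![z, x]]) ∨
  (∃ x y z, NZ3 x y z ∧ HasPattern B R K ![![x, x], ![y, z]]) ∨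
  (∃ x, NZ1 x ∧ HasPattern B R K ![![x, x, 0], ![x, 0, x]]) ∨
  (∃ x y, NZ2 x y ∧ HasPattern B R K ![![x, x, 0], ![x, 0, y]]) ∨
  (∃ x y, NZ2 x y ∧ HasPattern B R K ![![x, x, 0], ![y, 0, y]]) ∨
  (∃ x y, NZ2 x y ∧ HasPattern B R K ![![x, y, 0], ![x, 0, y]]) ∨
  (∃ x y z, NZ3 x y z ∧ HasPattern B R K ![![x, 0, 0], ![0, y, z]]) ∨
  (∃ x, NZ1 x ∧ HasPattern B R K ![![x, 0, 0], ![0, x, 0], ![0, 0, x]]) ∨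
  (∃ x y, NZ2 x y ∧ HasPattern B R K ![![x, 0, 0], ![0, x, 0], ![0, 0, y]]) ∨
  (∃ x y z, NZ3 x y z ∧ HasPattern B R K ![![x, 0, 0], ![0, y, 0], ![0, 0, z]]) ∨
  (∃ x y, NZ2 x y ∧ HasPattern B R K ![![x, y, x], ![y, y, 0], ![x, 0, 0]]) ∨
  (∃ x y z, NZ3 x y z ∧ HasPattern B R K ![![x, y, x], ![y, y, 0], ![x, 0, z]])

/-! ### The matroids `P₈⁻`, `F₇⁼` and its dual -/

/-- The columns of the GF(3)-matrix `[I₄ | A]` representing `P₈`, where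
`A = [[0,1,1,-1],[1,0,1,1],[1,1,0,1],[-1,1,1,0]]`. -/
def P8cols : Fin 8 → Fin 4 → ZMod 3 :=
  ![![1, 0, 0, 0], ![0, 1, 0, 0], ![0, 0, 1, 0], ![0, 0, 0, 1],
    ![0, 1, 1, -1], ![1, 0, 1, 1], ![1, 1, 0, 1], ![-1, 1, 1, 0]]

/-- `M` is isomorphic to `P₈`. -/
def IsP8 (M : Matroid α) : Prop :=
  ∃ g : α → Fin 8, Set.BijOn g M.E Set.univ ∧
    ∀ I ⊆ M.E, (M.Indep I ↔ LinearIndependent (ZMod 3) (fun x : I => P8cols (g (x : α))))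

/-- `M` is isomorphic to `P₈⁻`: it is obtained from a copy of `P₈` by relaxing one of its
pair of disjoint circuit-hyperplanes. -/
def IsP8Minus (M : Matroid α) : Prop :=
  ∃ (N : Matroid α) (X Y : Set α), IsP8 N ∧ CircuitHyperplane N Y ∧ Disjoint X Y ∧
    IsRelaxation N M X

/-- The columns of the rational matrix representing the non-Fano matroid `F₇⁻`: the seven
non-zero `{0,1}`-vectors of length 3. -/
def F7cols : Fin 7 → Fin 3 → ℚ :=
  ![![1, 0, 0], ![0, 1, 0], ![0, 0, 1], ![1, 1, 0], ![1, 0, 1], ![0, 1, 1], ![1, 1, 1]]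

/-- `M` is isomorphic to the non-Fano matroid `F₇⁻`. -/
def IsF7Minus (M : Matroid α) : Prop :=
  ∃ g : α → Fin 7, Set.BijOn g M.E Set.univ ∧
    ∀ I ⊆ M.E, (M.Indep I ↔ LinearIndependent ℚ (fun x : I => F7cols (g (x : α))))

/-- `M` is isomorphic to `F₇⁼`: it is obtained from a copy of `F₇⁻` by relaxing a
circuit-hyperplane. -/
def IsF7Eq (M : Matroid α) : Prop :=
  ∃ (N : Matroid α) (X : Set α), IsF7Minus N ∧ IsRelaxation N M X

end Relax

namespace Relax

variable {α K : Type*} [Field K]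

/-- The coordinate vectors outside `{p, q}` span the vectors vanishing at `p` and `q`. -/
lemma mem_span_image_diff_pair_iff {B : Set α} [Fintype B] {φ : α → B → K}
    (hφ : ∀ r : B, φ r = Pi.single r 1) (p q : B) (x : B → K) :
    x ∈ Submodule.span K (φ '' (B \ {(p : α), (q : α)})) ↔ x p = 0 ∧ x q = 0 := by
  constructor
  · intro hx
    refine Submodule.span_induction (p := fun x _ => x p = 0 ∧ x q = 0) ?_ (by simp) ?_ ?_ hx
    · rintro _ ⟨r, ⟨hr, hrpq⟩, rfl⟩
      simp only [mem_insert_iff, mem_singleton_iff, not_or] at hrpq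
      rw [hφ ⟨r, hr⟩]
      simp [Subtype.ext_iff, Ne.symm hrpq.1, Ne.symm hrpq.2]
    · rintro a b - - ⟨h₁, h₂⟩ ⟨h₃, h₄⟩
      simp [h₁, h₂, h₃, h₄]
    · rintro c a - ⟨h₁, h₂⟩
      simp [h₁, h₂]
  · rintro ⟨hp, hq⟩
    have hsum : x = ∑ r : B, x r • φ r := by
      ext s
      simp [hφ, Pi.single_apply, Finset.sum_apply]
    rw [hsum]
    refine Submodule.sum_mem _ fun r _ => ?_
    by_cases hrp : r = p
    · simp [hrp, hp]
    by_cases hrq : r = q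
    · simp [hrq, hq]
    · refine Submodule.smul_mem _ _ (Submodule.subset_span ⟨r, ⟨r.2, ?_⟩, rfl⟩)
      simp [← Subtype.ext_iff, hrp, hrq]

/-- Exchanging the coordinate vectors at `p` and `q` for the vectors indexed by `j` and `k`
preserves linear independence exactly when the corresponding `2 × 2` minor is nonzero. -/
lemma linearIndepOn_insert_insert_diff_pair_iff {B : Set α} [Fintype B] {φ : α → B → K}
    (hφ : ∀ r : B, φ r = Pi.single r 1) (p q : B) {j k : α} (hj : j ∉ B) (hk : k ∉ B)
    (hjk : j ≠ k) (hkq : φ k q ≠ 0) :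
    LinearIndepOn K φ (insert j (insert k (B \ {(p : α), (q : α)}))) ↔
      φ j p * φ k q ≠ φ j q * φ k p := by
  have hli : LinearIndepOn K φ B := by
    have h := (Pi.basisFun K B).linearIndependent
    have hb : (Pi.basisFun K B : B → B → K) = fun r : B => φ r := by
      ext r : 1
      rw [hφ, Pi.basisFun_apply]
    rwa [hb] at h
  have hli' := hli.mono (sdiff_subset (s := B) (t := {(p : α), (q : α)}))
  rw [linearIndepOn_insert (by simp [hj, hjk]), linearIndepOn_insert (by simp [hk]),
    image_insert_eq, Submodule.mem_span_insert, mem_span_image_diff_pair_iff hφ]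
  simp only [hli', hkq, and_false, not_false_eq_true, and_self, true_and, ne_eq, not_iff_not]
  constructor
  · rintro ⟨a, z, hz, hjz⟩
    rw [mem_span_image_diff_pair_iff hφ] at hz
    rw [hjz]
    simp only [Pi.add_apply, Pi.smul_apply, smul_eq_mul, hz.1, hz.2]
    ring
  · intro h
    refine ⟨φ j q / φ k q, φ j - (φ j q / φ k q) • φ k, ?_, by simp⟩
    rw [mem_span_image_diff_pair_iff hφ]
    simp only [Pi.sub_apply, Pi.smul_apply, smul_eq_mul]
    rw [div_mul_eq_mul_div, ← h, mul_div_cancel_right₀ _ hkq, div_mul_cancel₀ _ hkq]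
    simp

/-- Relaxing `X` does not affect the independence of any other set of the size of a base. -/
lemma IsRelaxation.indep_iff {M M' : Matroid α} {X B I : Set α} (h : IsRelaxation M M' X)
    (hB : M.IsBase B) (hBfin : B.Finite) (hI : I.encard = B.encard) (hIX : I ≠ X) :
    M.Indep I ↔ M'.Indep I := by
  have key : ∀ {N : Matroid α}, N.IsBase B → (N.Indep I ↔ N.IsBase I) := by
    intro N hN
    refine ⟨fun hi => ?_, fun hb => hb.indep⟩
    obtain ⟨D, hD, hID⟩ := hi.exists_isBase_superset
    have hle : D.encard ≤ I.encard := by rw [hI, hD.encard_eq_encard_of_isBase hN]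
    rwa [(hN.finite_of_finite hBfin hD).eq_of_subset_of_encard_le' hID hle]
  rw [key hB, key ((h.2.2 B).2 (.inl hB)), h.2.2]
  simp [hIX]

lemma colVec_of_mem {X : Set α} {e f : α} (A : α → α → GF4) (w : GF4)
    (r : (X \ {e} ∪ {f} : Set α)) : colVec X e f A w r = Pi.single r 1 := by
  ext s
  simp only [colVec, if_pos r.2, Pi.single_apply, Subtype.ext_iff]

/-- Relaxation preserves the vanishing of every `2 × 2` minor of the reduced representation
whose corresponding exchange of basis elements does not produce `X`. -/
lemma IsRelaxation.minor_ne_iff {M M' : Matroid α} {X : Set α} {e f : α}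
    {A A' : α → α → GF4} {w w' : GF4} (hfin : M.E.Finite) (h : IsRelaxation M M' X)
    (hB : M.IsBase (X \ {e} ∪ {f})) (hA : RepBy M X e f A w) (hA' : RepBy M' X e f A' w')
    (p q : (X \ {e} ∪ {f} : Set α)) (hpq : p ≠ q) {j k : α} (hj : j ∈ M.E) (hk : k ∈ M.E)
    (hjB : j ∉ X \ {e} ∪ {f}) (hkB : k ∉ X \ {e} ∪ {f}) (hjk : j ≠ k) (hjX : j ∉ X)
    (hkq : colVec X e f A w k q ≠ 0) (hkq' : colVec X e f A' w' k q ≠ 0) :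
    colVec X e f A w j p * colVec X e f A w k q ≠ colVec X e f A w j q * colVec X e f A w k p ↔
      colVec X e f A' w' j p * colVec X e f A' w' k q ≠
        colVec X e f A' w' j q * colVec X e f A' w' k p := by
  have hBfin := hfin.subset hB.subset_ground
  let _ := hBfin.fintype
  have hIE : insert j (insert k ((X \ {e} ∪ {f}) \ {(p : α), (q : α)})) ⊆ M.E :=
    insert_subset hj (insert_subset hk (sdiff_subset.trans hB.subset_ground))
  rw [← linearIndepOn_insert_insert_diff_pair_iff (colVec_of_mem A w) p q hjB hkB hjk hkq,
    ← linearIndepOn_insert_insert_diff_pair_iff (colVec_of_mem A' w') p q hjB hkB hjk hkq']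
  refine (hA _ hIE).symm.trans ((h.indep_iff hB hBfin ?_ ?_).trans (hA' _ (h.2.1 ▸ hIE)))
  · have hpair : ({(p : α), (q : α)} : Set α).encard = 2 :=
      encard_pair (Subtype.coe_ne_coe.2 hpq)
    rw [encard_insert_of_notMem (by simp [-union_singleton, hjB, hjk]),
      encard_insert_of_notMem (fun hmem => hkB hmem.1),
      ← encard_sdiff_add_encard_of_subset (pair_subset p.2 q.2), hpair, add_assoc]
    norm_num
  · exact fun hX => hjX (hX ▸ mem_insert _ _)

end Relax

/-- With the setup as given: for any row `i ∈ X − e` and columns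
`j, k ∈ (E − X) − f`, `A_{ij} = A_{ik}` iff `A'_{ij} = A'_{ik}`; and for any rows
`i, k ∈ X − e` and column `j ∈ (E − X) − f`, `A_{ij} = A_{kj}` iff `A'_{ij} = A'_{kj}`. -/
theorem statement13 {α : Type*} (M M' : Matroid α) (X : Set α) (e f : α)
    (A A' : α → α → Relax.GF4) (w : Relax.GF4)
    (hfin : M.E.Finite)
    (hrel : Relax.IsRelaxation M M' X)
    (he : e ∈ X) (hf : f ∈ M.E \ X)
    (hB : M.IsBase (X \ {e} ∪ {f}))
    (hA : Relax.RepBy M X e f A 0)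
    (hw0 : w ≠ 0) (hw1 : w ≠ 1)
    (hA' : Relax.RepBy M' X e f A' w) :
    (∀ i ∈ X \ {e}, ∀ j ∈ (M.E \ X) \ {f}, ∀ k ∈ (M.E \ X) \ {f},
        (A i j = A i k ↔ A' i j = A' i k)) ∧
    (∀ i ∈ X \ {e}, ∀ k ∈ X \ {e}, ∀ j ∈ (M.E \ X) \ {f},
        (A i j = A k j ↔ A' i j = A' k j)) := by
  have heB : e ∉ X \ {e} ∪ ({f} : Set α) := by
    rintro (h | h)
    · exact h.2 rfl
    · exact hf.2 (h ▸ he)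
  have hjB : ∀ j ∈ (M.E \ X) \ {f}, j ∉ X \ {e} ∪ ({f} : Set α) ∧ j ≠ e := fun j hj =>
    ⟨fun h => h.elim (fun h => hj.1.2 h.1) hj.2, fun h => hj.1.2 (h ▸ he)⟩
  have hif : ∀ i ∈ X \ {e}, i ≠ f := fun i hi h => hf.2 (h ▸ hi.1)
  have heE : e ∈ M.E := hrel.1.1.1.subset_ground he
  refine ⟨fun i hi j hj k hk => ?_, fun i hi k hk j hj => ?_⟩
  · obtain rfl | hjk := eq_or_ne j k
    · simp
    have h := hrel.minor_ne_iff hfin hB hA hA' ⟨i, .inl hi⟩ ⟨f, .inr rfl⟩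
      (Subtype.coe_ne_coe.1 (hif i hi)) hj.1.1 hk.1.1 (hjB j hj).1 (hjB k hk).1 hjk hj.1.2
    simpa [Relax.colVec, -union_singleton, hjB j hj, hjB k hk, hif i hi, not_iff_not] using h
  · obtain rfl | hik := eq_or_ne i k
    · simp
    have h := hrel.minor_ne_iff hfin hB hA hA' ⟨i, .inl hi⟩ ⟨k, .inl hk⟩
      (Subtype.coe_ne_coe.1 hik) hj.1.1 heE (hjB j hj).1 heB (hjB j hj).2 hj.1.2
    simpa [Relax.colVec, -union_singleton, hjB j hj, heB, hif i hi, hif k hk, not_iff_not] using h
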